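/- arXiv:2207.08507 — 2 statements merged into one kernel-verified Lean document; each statement's English description precedes it below -/
import Mathlib

section
/- A permutation g of F₂₇ is a symmetry of the tournament Γ if and only if there exist a nonzero square a ∈ F₂₇, an element b ∈ F₂₇, and k ∈ {0, 1, 2} such that g(x) = a·x^(3^k) + b for all x ∈ F₂₇. -/
/-- `F₂₇`, a finite field with 27 elements. -/
abbrev F27 : Type := GaloisField 3 3

/-- `a` is a nonzero square in `F₂₇`. -/
def IsNonzeroSquare (a : F27) : Prop := a ≠ 0 ∧ ∃ c : F27, a = c ^ 2

/-- `g` is a symmetry of the tournament `Γ` on `F₂₇` whose directed edges `(a, b)`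
are the pairs with `b - a` a nonzero square. -/
def IsTournamentSym (g : Equiv.Perm F27) : Prop :=
  ∀ a b : F27, IsNonzeroSquare (b - a) ↔ IsNonzeroSquare (g b - g a)

/-- Concrete model of the field: a + b t + c t^2 with t^3 = t + 1. -/
@[ext]
structure K3 where
  a : ZMod 3
  b : ZMod 3
  c : ZMod 3

namespace K3

instance : DecidableEq K3 := fun x y =>
  decidable_of_iff (x.a = y.a ∧ x.b = y.b ∧ x.c = y.c) K3.ext_iff.symm

instance : Zero K3 := ⟨⟨0, 0, 0⟩⟩
instance : One K3 := ⟨⟨1, 0, 0⟩⟩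
instance : Add K3 := ⟨fun x y => ⟨x.a + y.a, x.b + y.b, x.c + y.c⟩⟩
instance : Neg K3 := ⟨fun x => ⟨-x.a, -x.b, -x.c⟩⟩
instance : Mul K3 := ⟨fun x y =>
  ⟨x.a * y.a + (x.b * y.c + x.c * y.b),
   x.a * y.b + x.b * y.a + (x.b * y.c + x.c * y.b) + x.c * y.c,
   x.a * y.c + x.b * y.b + x.c * y.a + x.c * y.c⟩⟩

@[simp] lemma zero_a : (0 : K3).a = 0 := rfl
@[simp] lemma zero_b : (0 : K3).b = 0 := rfl
@[simp] lemma zero_c : (0 : K3).c = 0 := rfl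
@[simp] lemma one_a : (1 : K3).a = 1 := rfl
@[simp] lemma one_b : (1 : K3).b = 0 := rfl
@[simp] lemma one_c : (1 : K3).c = 0 := rfl
@[simp] lemma add_a (x y : K3) : (x + y).a = x.a + y.a := rfl
@[simp] lemma add_b (x y : K3) : (x + y).b = x.b + y.b := rfl
@[simp] lemma add_c (x y : K3) : (x + y).c = x.c + y.c := rfl
@[simp] lemma neg_a (x : K3) : (-x).a = -x.a := rfl
@[simp] lemma neg_b (x : K3) : (-x).b = -x.b := rfl
@[simp] lemma neg_c (x : K3) : (-x).c = -x.c := rfl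
@[simp] lemma mul_a (x y : K3) : (x * y).a = x.a * y.a + (x.b * y.c + x.c * y.b) := rfl
@[simp] lemma mul_b (x y : K3) :
    (x * y).b = x.a * y.b + x.b * y.a + (x.b * y.c + x.c * y.b) + x.c * y.c := rfl
@[simp] lemma mul_c (x y : K3) :
    (x * y).c = x.a * y.c + x.b * y.b + x.c * y.a + x.c * y.c := rfl

instance : CommRing K3 where
  add_assoc x y z := by ext <;> simp <;> ring
  zero_add x := by ext <;> simp
  add_zero x := by ext <;> simp
  add_comm x y := by ext <;> simp <;> ring
  neg_add_cancel x := by ext <;> simp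
  mul_assoc x y z := by ext <;> simp <;> ring
  one_mul x := by ext <;> simp
  mul_one x := by ext <;> simp
  zero_mul x := by ext <;> simp
  mul_zero x := by ext <;> simp
  left_distrib x y z := by ext <;> simp <;> ring
  right_distrib x y z := by ext <;> simp <;> ring
  mul_comm x y := by ext <;> simp <;> ring
  nsmul := nsmulRec
  zsmul := zsmulRec

/-- Numbering of the elements. -/
def dec (i : ℕ) : K3 := ⟨(i % 3 : ℕ), (i / 3 % 3 : ℕ), (i / 9 : ℕ)⟩

/-- Inverse of the numbering. -/
def code (x : K3) : ℕ := x.a.val + 3 * x.b.val + 9 * x.c.val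

lemma code_lt (x : K3) : code x < 27 := by
  have := ZMod.val_lt x.a
  have := ZMod.val_lt x.b
  have := ZMod.val_lt x.c
  unfold code; omega

lemma dec_code (x : K3) : dec (code x) = x := by
  obtain ⟨a, b, c⟩ := x
  revert a b c
  decide +kernel

lemma code_dec : ∀ i < 27, code (dec i) = i := by decide +kernel

/-- The numbering as an equivalence. -/
def equivFin : K3 ≃ Fin 27 where
  toFun x := ⟨code x, code_lt x⟩
  invFun i := dec i
  left_inv x := dec_code x
  right_inv i := Fin.ext (code_dec i i.2)

instance : Fintype K3 := Fintype.ofEquiv _ equivFin.symm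

lemma card_K3 : Fintype.card K3 = 27 := by
  rw [Fintype.card_congr equivFin, Fintype.card_fin]

lemma forall_dec {P : K3 → Prop} (h : ∀ i < 27, P (dec i)) (x : K3) : P x := by
  rw [← dec_code x]; exact h _ (code_lt x)

instance : Field K3 where
  inv := fun x => x ^ 25
  exists_pair_ne := ⟨0, 1, by decide +kernel⟩
  mul_inv_cancel := by
    apply forall_dec
    show ∀ i < 27, dec i ≠ 0 → dec i * dec i ^ 25 = 1
    decide +kernel
  inv_zero := by
    show (0 : K3) ^ 25 = 0
    simp
  nnqsmul := _
  nnqsmul_def := fun _ _ => rfl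
  qsmul := _
  qsmul_def := fun _ _ => rfl

/-- Nonzero squares of the model. -/
def Sq (x : K3) : Prop := x ≠ 0 ∧ ∃ c, x = c ^ 2

lemma Sq_iff : ∀ x : K3, Sq x ↔ x ^ 13 = 1 := by
  intro x
  constructor
  · rintro ⟨h, c, rfl⟩
    have : ∀ c : K3, c ^ 2 ≠ 0 → (c ^ 2) ^ 13 = 1 := by
      apply forall_dec
      decide +kernel
    exact this c h
  · intro h
    refine ⟨?_, x ^ 7, ?_⟩
    · rintro rfl
      simp at h
    · calc x = x * x ^ 13 := by rw [h, mul_one]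
        _ = _ := by ring

/-- Adjacency rows. -/
def rows : List ℕ := [38910522, 75982396, 19586105, 42588112, 70467040, 21425096, 72005255, 26340615, 36133447, 57963668, 114063649, 95973962, 61841570, 108773644, 98013265, 91033362, 64622180, 112496265, 15280349, 15877043, 14980462, 121717995, 125966750, 119579509, 35530075, 68995318, 18682797]

/-- Adjacency of codes. -/
def adj (i j : ℕ) : Bool := (rows.getD i 0).testBit j

lemma adj_iff : ∀ i < 27, ∀ j < 27, (adj i j = true ↔ (dec j - dec i) ^ 13 = 1) := by
  decide +kernel

/-- Compatibility of an assignment with a new pair. -/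
def compat (v w : ℕ) (done : List (ℕ × ℕ)) : Bool :=
  done.all fun p => (adj p.1 v == adj p.2 w) && (adj v p.1 == adj w p.2)

/-- Leaf test. -/
def leaf (done : List (ℕ × ℕ)) : Bool :=
  (List.range 3).any fun k => done.all fun p => decide (dec p.2 = dec p.1 ^ 3 ^ k)

/-- Backtracking search. -/
def search : List ℕ → List (ℕ × ℕ) → Bool
  | [], done => leaf done
  | v :: vs, done => (List.range 27).all fun w =>
      bif compat v w done then search vs ((v, w) :: done) else true

lemma search_sound (F : ℕ → ℕ) (hF : ∀ i < 27, F i < 27)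
    (hA : ∀ i < 27, ∀ j < 27, adj i j = adj (F i) (F j)) :
    ∀ (vs us : List ℕ), (∀ i ∈ vs, i < 27) → (∀ i ∈ us, i < 27) →
      search vs (us.map fun i => (i, F i)) = true →
      leaf ((vs.reverse ++ us).map fun i => (i, F i)) = true := by
  intro vs
  induction vs with
  | nil => intro us _ _ h; simpa [search] using h
  | cons v vs ih =>
    intro us hv hu h
    have hv0 : v < 27 := hv v (by simp)
    rw [search, List.all_eq_true] at h
    have h1 := h (F v) (List.mem_range.2 (hF v hv0))
    have hc : compat v (F v) (us.map fun i => (i, F i)) = true := by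
      simp only [compat, List.all_eq_true, List.mem_map]
      rintro p ⟨i, hi, rfl⟩
      simp [← hA i (hu i hi) v hv0, ← hA v hv0 i (hu i hi)]
    rw [hc, cond_true] at h1
    have := ih (v :: us) (fun i hi => hv i (by simp [hi]))
      (by intro i hi; rcases List.mem_cons.1 hi with rfl | hi; exacts [hv0, hu i hi])
      (by simpa using h1)
    simpa using this

lemma search_true : search ((List.range 25).map (· + 2)) [(1, 1), (0, 0)] = true := by
  decide +kernel

lemma key_lemma (f : K3 → K3) (h0 : f 0 = 0) (h1 : f 1 = 1)
    (hf : ∀ x y, Sq (y - x) ↔ Sq (f y - f x)) :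
    ∃ k ≤ 2, ∀ x, f x = x ^ 3 ^ k := by
  have d0 : dec 0 = 0 := by decide +kernel
  have d1 : dec 1 = 1 := by decide +kernel
  have c0 : code 0 = 0 := by decide +kernel
  have c1 : code 1 = 1 := by decide +kernel
  have := search_sound (fun i => code (f (dec i))) (fun i _ => code_lt _)
    (by
      intro i hi j hj
      rw [Bool.eq_iff_iff, adj_iff i hi j hj, adj_iff _ (code_lt _) _ (code_lt _),
        dec_code, dec_code, ← Sq_iff, ← Sq_iff]
      exact hf _ _)
    ((List.range 25).map (· + 2)) [1, 0] (by simp; omega) (by simp)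
    (by simpa only [List.map_cons, List.map_nil, d0, d1, h0, h1, c0, c1] using search_true)
  simp only [leaf, List.any_eq_true, List.mem_range, List.all_eq_true, decide_eq_true_eq,
    List.mem_map] at this
  obtain ⟨k, hk, h⟩ := this
  refine ⟨k, by omega, forall_dec fun i hi => ?_⟩
  have hm : ∀ i < 27, i ∈ ((List.range 25).map (· + 2)).reverse ++ [1, 0] := by decide +kernel
  have := h _ ⟨i, hm i hi, rfl⟩
  simpa [dec_code] using this

end K3

/-- The model is isomorphic to the Galois field. -/
theorem exists_K3_equiv : Nonempty (F27 ≃+* K3) := by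
  have : Fintype F27 := Fintype.ofFinite _
  refine ⟨FiniteField.ringEquivOfCardEq ?_⟩
  rw [K3.card_K3, ← Nat.card_eq_fintype_card, GaloisField.card 3 3 (by norm_num)]
  norm_num

theorem nzsq_iff (e : F27 ≃+* K3) (x : F27) : IsNonzeroSquare x ↔ K3.Sq (e x) := by
  unfold IsNonzeroSquare K3.Sq
  constructor
  · rintro ⟨h, c, rfl⟩
    exact ⟨by simpa using h, e c, by simp⟩
  · rintro ⟨h, c, hc⟩
    refine ⟨by rintro rfl; simp at h, e.symm c, ?_⟩
    apply e.injective
    simp [hc]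

theorem nzsq_pow (x : F27) : IsNonzeroSquare x ↔ x ^ 13 = 1 := by
  obtain ⟨e⟩ := exists_K3_equiv
  rw [nzsq_iff e, K3.Sq_iff, ← map_pow, map_eq_one_iff e e.injective]

theorem frob_inj (x : F27) (k : ℕ) : (x ^ 3 ^ k) ^ 13 = 1 ↔ x ^ 13 = 1 := by
  rw [← pow_mul, mul_comm, pow_mul]
  constructor
  · intro h
    have := sub_pow_char_pow (p := 3) (x ^ 13) 1 k
    rw [h, one_pow, sub_self] at this
    exact sub_eq_zero.1 (pow_eq_zero_iff (by positivity) |>.1 this)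
  · intro h; rw [h, one_pow]

/-- A permutation of `F₂₇` is a symmetry of the tournament `Γ` if and only if it has the
form `x ↦ a·x^(3^k) + b` with `a` a nonzero square, `b ∈ F₂₇` and `k ∈ {0, 1, 2}`. -/
theorem statement8 (g : Equiv.Perm F27) :
    IsTournamentSym g ↔
      ∃ a b : F27, IsNonzeroSquare a ∧
        ∃ k : ℕ, k ≤ 2 ∧ ∀ x : F27, g x = a * x ^ (3 ^ k) + b := by
  constructor
  · intro hg
    obtain ⟨e⟩ := exists_K3_equiv
    have ha : IsNonzeroSquare (g 1 - g 0) := by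
      rw [← hg 0 1, nzsq_pow]; simp
    have ha0 : g 1 - g 0 ≠ 0 := ha.1
    obtain ⟨k, hk, h⟩ := K3.key_lemma
      (fun x => e ((g (e.symm x) - g 0) / (g 1 - g 0))) (by simp) (by simp [div_self ha0]) (by
        intro x y
        have h1 := hg (e.symm x) (e.symm y)
        rw [← map_sub, nzsq_iff e, e.apply_symm_apply] at h1
        rw [h1, ← map_sub e, ← nzsq_iff, ← sub_div, sub_sub_sub_cancel_right, nzsq_pow, nzsq_pow,
          div_pow, (nzsq_pow _).1 ha, div_one])
    refine ⟨g 1 - g 0, g 0, ha, k, hk, fun x => ?_⟩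
    have := h (e x)
    simp only [e.symm_apply_apply, ← map_pow] at this
    rw [← e.injective this]
    field_simp
    ring
  · rintro ⟨a, b, ha, k, _, h⟩ x y
    rw [h, h, add_sub_add_right_eq_sub, ← mul_sub, ← sub_pow_char_pow (p := 3), nzsq_pow,
      nzsq_pow, mul_pow, (nzsq_pow a).1 ha, one_mul, frob_inj]
end

section
/- The group G₃₅₁ has exactly one subgroup of order 27 (which is normal), exactly 13 subgroups of order 3, exactly 13 subgroups of order 9, and exactly 27 subgroups of order 13; moreover, any two subgroups of G₃₅₁ of the same order are conjugate in G₃₅₁. Consequently, G₃₅₁ has exactly 6 conjugacy classes of subgroups. -/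
/-- The set of affine permutations `x ↦ a·x + b` with `a` a nonzero square. -/
def affineSet : Set (Equiv.Perm F27) :=
  { g | ∃ a b : F27, IsNonzeroSquare a ∧ ∀ x : F27, g x = a * x + b }

open scoped Pointwise

theorem f27_card : Nat.card F27 = 27 := by
  have := GaloisField.card 3 3 (by norm_num)
  simpa using this

theorem f27_units_card : Nat.card F27ˣ = 26 := by
  rw [Nat.card_units, f27_card]

theorem f27_two : (2 : F27) = -1 := by
  have h : ((3 : ℕ) : F27) = 0 := CharP.cast_eq_zero F27 3
  push_cast at h
  linear_combination h

theorem f27_square_or (u : F27ˣ) : ∃ c : F27ˣ, u = c ^ 2 ∨ u = - c ^ 2 := by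
  have hfin : Fintype F27 := Fintype.ofFinite _
  have hcard : Fintype.card F27 = 27 := by rw [← Nat.card_eq_fintype_card, f27_card]
  have hchar : ringChar F27 ≠ 2 := by
    rw [ringChar.eq F27 3]; norm_num
  have key : ∀ v : F27ˣ, (v : F27) ^ 13 = 1 → ∃ c : F27ˣ, v = c ^ 2 := by
    intro v hv
    have h := (FiniteField.isSquare_iff hchar v.ne_zero).2 (by rw [hcard]; exact hv)
    obtain ⟨c, hc⟩ := h
    have hc0 : c ≠ 0 := by
      rintro rfl
      exact v.ne_zero (by simpa using hc)
    refine ⟨Units.mk0 c hc0, ?_⟩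
    ext
    simp [hc, sq]
  have h26 : (u : F27) ^ 26 = 1 := by
    have : u ^ 26 = 1 := by rw [← f27_units_card]; exact pow_card_eq_one'
    simpa using congrArg Units.val this
  have : ((u : F27) ^ 13 - 1) * ((u : F27) ^ 13 + 1) = 0 := by linear_combination h26
  rcases mul_eq_zero.1 this with h | h
  · obtain ⟨c, hc⟩ := key u (by linear_combination h)
    exact ⟨c, Or.inl hc⟩
  · obtain ⟨c, hc⟩ := key (-u) (by push_cast; linear_combination -h)
    exact ⟨c, Or.inr (by rw [← hc, neg_neg])⟩

/-- Abstract data describing the affine group `F ⋊ squares`. -/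
structure Aff (G : Type) [Group G] where
  lin : G →* F27ˣ
  tr : F27 → G
  tr_add : ∀ b c, tr (b + c) = tr b * tr c
  tr_inj : Function.Injective tr
  ker : ∀ g, lin g = 1 ↔ ∃ b, g = tr b
  range : ∀ u, (∃ g, lin g = u) ↔ ∃ c, u = c ^ 2
  conj : ∀ g b, g * tr b * g⁻¹ = tr (lin g * b)

theorem exists_aff (G : Subgroup (Equiv.Perm F27))
    (hG : (G : Set (Equiv.Perm F27)) = affineSet) : Nonempty (Aff G) := by
  have hmem : ∀ g : Equiv.Perm F27, g ∈ G ↔ g ∈ affineSet := fun g => by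
    rw [← hG]; rfl
  have hex : ∀ g : G, ∃ u : F27ˣ, ∃ b : F27, (∃ c : F27ˣ, u = c ^ 2) ∧
      ∀ x, (g : Equiv.Perm F27) x = u * x + b := by
    rintro ⟨g, hg⟩
    obtain ⟨a, b, ⟨ha, c, hc⟩, h⟩ := (hmem g).1 hg
    have hc0 : c ≠ 0 := by rintro rfl; exact ha (by simpa using hc)
    refine ⟨Units.mk0 a ha, b, ⟨Units.mk0 c hc0, ?_⟩, h⟩
    ext; simpa using hc
  choose l t hsq hl using hex
  have hluniq : ∀ (g : G) (u : F27ˣ) (b : F27),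
      (∀ x, (g : Equiv.Perm F27) x = u * x + b) → l g = u := by
    intro g u b h
    ext
    have h0 := h 0
    have h1 := h 1
    rw [hl] at h0 h1
    linear_combination h1 - h0
  have hmk : ∀ (c : F27ˣ) (b : F27), ∃ g : G, ∀ x, (g : Equiv.Perm F27) x = (c ^ 2 : F27ˣ) * x + b := by
    intro c b
    refine ⟨⟨(Units.mulLeft (c ^ 2)).trans (Equiv.addRight b), ?_⟩, ?_⟩
    · rw [hmem]
      refine ⟨(c ^ 2 : F27ˣ), b, ⟨Units.ne_zero _, c, by simp⟩, ?_⟩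
      intro x
      simp
    · intro x
      simp
  choose m hm using hmk
  have hext : ∀ g h : G, (∀ x, (g : Equiv.Perm F27) x = (h : Equiv.Perm F27) x) → g = h := by
    intro g h H
    exact Subtype.ext (Equiv.ext H)
  have htr : ∀ b x, ((m 1 b : G) : Equiv.Perm F27) x = x + b := by
    intro b x; rw [hm]; simp
  refine ⟨{ lin := MonoidHom.mk' l ?_, tr := m 1, tr_add := ?_, tr_inj := ?_, ker := ?_, range := ?_, conj := ?_ }⟩
  · intro g h
    refine hluniq (g * h) _ (l g * t h + t g) ?_
    intro x
    simp only [Subgroup.coe_mul, Equiv.Perm.mul_apply, hl, Units.val_mul]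
    ring
  · intro b c
    apply hext
    intro x
    simp only [Subgroup.coe_mul, Equiv.Perm.mul_apply, htr]
    ring
  · intro b c h
    have := htr b 0
    rw [h, htr] at this
    simpa using this.symm
  · intro g
    constructor
    · intro h
      refine ⟨t g, hext _ _ fun x => ?_⟩
      have h' : l g = 1 := h
      rw [htr, hl, h']; simp
    · rintro ⟨b, rfl⟩
      exact hluniq _ 1 b (by simp [htr])
  · intro u
    constructor
    · rintro ⟨g, rfl⟩
      exact hsq g
    · rintro ⟨c, rfl⟩
      exact ⟨m c 0, hluniq _ _ 0 (hm c 0)⟩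
  · intro g b
    rw [mul_inv_eq_iff_eq_mul]
    apply hext
    intro x
    simp only [Subgroup.coe_mul, Equiv.Perm.mul_apply, htr, hl, MonoidHom.mk'_apply]
    ring

namespace Aff

variable {G : Type} [Group G]

/-- The translation subgroup. -/
noncomputable def T (A : Aff G) : Subgroup G := A.lin.ker

theorem mem_T (A : Aff G) {g : G} : g ∈ A.T ↔ ∃ b, g = A.tr b := A.ker g

theorem tr_mem (A : Aff G) (b : F27) : A.tr b ∈ A.T := A.mem_T.2 ⟨b, rfl⟩

theorem tr_zero (A : Aff G) : A.tr 0 = 1 := by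
  have := A.tr_add 0 0
  simpa using this

theorem tr_neg (A : Aff G) (b : F27) : A.tr (-b) = (A.tr b)⁻¹ := by
  rw [eq_inv_iff_mul_eq_one, ← A.tr_add]; simp [A.tr_zero]

theorem card_T (A : Aff G) : Nat.card A.T = 27 := by
  rw [← f27_card]
  refine (Nat.card_congr (Equiv.ofBijective (fun b => (⟨A.tr b, A.tr_mem b⟩ : A.T)) ⟨?_, ?_⟩)).symm
  · intro b c h
    exact A.tr_inj (congrArg Subtype.val h)
  · rintro ⟨g, hg⟩
    obtain ⟨b, rfl⟩ := A.mem_T.1 hg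
    exact ⟨b, rfl⟩

theorem index_T (A : Aff G) : A.T.index = 13 := by
  have h : A.lin.range = (powMonoidHom 2 : F27ˣ →* F27ˣ).range := by
    ext u
    rw [MonoidHom.mem_range, A.range, MonoidHom.mem_range]
    simp [eq_comm]
  rw [T, Subgroup.index_ker, h, IsCyclic.card_powMonoidHom_range, f27_units_card]
  norm_num

theorem card_G (A : Aff G) : Nat.card G = 351 := by
  rw [← A.T.card_mul_index, A.card_T, A.index_T]

theorem finite (A : Aff G) : Finite G := Nat.finite_of_card_ne_zero (by rw [A.card_G]; norm_num)

theorem T_normal (A : Aff G) : A.T.Normal := inferInstanceAs A.lin.ker.Normal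

/-- subgroups of order dividing 27 are made of translations. -/
theorem le_T (A : Aff G) {H : Subgroup G} (h : Nat.card H ∣ 27) : H ≤ A.T := by
  intro g hg
  have h27 : A.lin g ^ 27 = 1 := by

    have h1 : (⟨g, hg⟩ : H) ^ 27 = 1 := by
      obtain ⟨k, hk⟩ := h
      rw [hk, pow_mul, pow_card_eq_one', one_pow]
    have h2 : g ^ 27 = 1 := congrArg Subtype.val h1
    rw [← map_pow, h2, map_one]
  obtain ⟨c, hc⟩ := (A.range (A.lin g)).1 ⟨g, rfl⟩
  have h13 : A.lin g ^ 13 = 1 := by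
    rw [hc, ← pow_mul, ← pow_card_eq_one' (x := c), f27_units_card]
  show A.lin g = 1
  calc A.lin g = A.lin g ^ 27 * ((A.lin g ^ 13) ^ 2)⁻¹ := by group
    _ = 1 := by rw [h27, h13]; simp

/-- The conjugation action on subgroups. -/
abbrev act (G : Type) [Group G] : MulAction G (Subgroup G) :=
  MulAction.compHom (Subgroup G) (MulAut.conj : G →* MulAut G)

/-- Stabilizer under conjugation. -/
def stab (H : Subgroup G) : Subgroup G := @MulAction.stabilizer G (Subgroup G) _ (act G) H

theorem mem_stab {H : Subgroup G} {g : G} :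
    g ∈ stab H ↔ Subgroup.map (MulAut.conj g).toMonoidHom H = H := Iff.rfl

theorem index_stab (H : Subgroup G) : (stab H).index =
    { H' | ∃ g : G, Subgroup.map (MulAut.conj g).toMonoidHom H = H' }.ncard :=
  @MulAction.index_stabilizer G (Subgroup G) _ (act G) H

theorem card_conj (H : Subgroup G) (g : G) :
    Nat.card (Subgroup.map (MulAut.conj g).toMonoidHom H) = Nat.card H :=
  Subgroup.card_map_of_injective (MulAut.conj g).injective

theorem mem_stab_of [Finite G] {H : Subgroup G} {g : G} (h : ∀ x ∈ H, g * x * g⁻¹ ∈ H) :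
    g ∈ stab H := by
  rw [mem_stab]
  apply Subgroup.eq_of_le_of_card_ge
  · rintro _ ⟨x, hx, rfl⟩
    exact h x hx
  · rw [card_conj]

theorem stab_conj {H : Subgroup G} {g x : G} (h : g ∈ stab H) (hx : x ∈ H) :
    g * x * g⁻¹ ∈ H := by
  rw [mem_stab] at h
  rw [← h]
  exact ⟨x, hx, rfl⟩

theorem T_le_stab (A : Aff G) {H : Subgroup G} (h : H ≤ A.T) : A.T ≤ stab H := by
  have := A.finite
  intro g hg
  apply mem_stab_of
  intro x hx
  obtain ⟨b, rfl⟩ := A.mem_T.1 (h hx)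
  have hg' : A.lin g = 1 := hg
  rw [A.conj, hg']
  simpa using hx

/-- A nontrivial normal subgroup inside `T` is large. -/
theorem big (A : Aff G) {H : Subgroup G} (h : H ≤ A.T) (hne : H ≠ ⊥) (hs : stab H = ⊤) : 13 ≤ Nat.card H := by
  have := A.finite
  obtain ⟨x, hx, hx1⟩ := Subgroup.ne_bot_iff_exists_ne_one.1 hne |>.elim
    fun x hx => (⟨x.1, x.2, fun h => hx (Subtype.ext h)⟩ : ∃ x ∈ H, x ≠ 1)
  obtain ⟨b, rfl⟩ := A.mem_T.1 (h hx)
  have hb : b ≠ 0 := by rintro rfl; exact hx1 A.tr_zero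
  have hr : Nat.card A.lin.range = 13 := by
    rw [← Subgroup.index_ker]; exact A.index_T
  rw [← hr]
  refine Nat.card_le_card_of_injective
    (fun u : A.lin.range => (⟨A.tr (u.1 * b), ?_⟩ : H)) ?_
  · obtain ⟨_, g, rfl⟩ := u
    rw [← A.conj]
    exact stab_conj (hs ▸ Subgroup.mem_top g) hx
  · intro u v huv
    have h1 := A.tr_inj (congrArg Subtype.val huv)
    exact Subtype.ext (Units.ext (mul_right_cancel₀ hb h1))

theorem index_stab_small (A : Aff G) {H : Subgroup G} (h : Nat.card H ∣ 27) (h1 : 1 < Nat.card H)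
    (h2 : Nat.card H < 13) : (stab H).index = 13 := by
  have := A.finite
  have hT := A.le_T h
  have hd := Subgroup.index_dvd_of_le (A.T_le_stab hT)
  rw [A.index_T, Nat.dvd_prime (by norm_num)] at hd
  rcases hd with hd | hd
  · exfalso
    have := A.big hT (by rintro rfl; simp at h1) (Subgroup.index_eq_one.1 hd)
    omega
  · exact hd

theorem eq_top (A : Aff G) {H : Subgroup G} (h13 : 13 ∣ Nat.card H) (h3 : 3 ∣ Nat.card H) : H = ⊤ := by
  have := A.finite
  have full : ∀ K : Subgroup G, 13 ∣ Nat.card K → A.T ≤ K → K = ⊤ := by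
    intro K hK hT
    apply Subgroup.eq_top_of_card_eq
    apply Nat.dvd_antisymm (Subgroup.card_subgroup_dvd_card K)
    have h27 := Subgroup.card_dvd_of_le hT
    rw [A.card_T] at h27
    rw [A.card_G]
    exact Nat.Coprime.mul_dvd_of_dvd_of_dvd (m := 13) (n := 27) (by norm_num) hK h27
  apply full H h13
  have hHs : H ≤ stab (H ⊓ A.T) := by
    intro g hg
    apply mem_stab_of
    rintro x ⟨hx, hxT⟩
    exact ⟨H.mul_mem (H.mul_mem hg hx) (H.inv_mem hg), A.T_normal.conj_mem x hxT g⟩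
  have hs : stab (H ⊓ A.T) = ⊤ :=
    full _ (h13.trans (Subgroup.card_dvd_of_le hHs)) (A.T_le_stab inf_le_right)
  have hne : H ⊓ A.T ≠ ⊥ := by
    have : Fact (Nat.Prime 3) := ⟨by norm_num⟩
    obtain ⟨x, hx⟩ := exists_prime_orderOf_dvd_card' (G := H) 3 h3
    intro hb
    have hxo : orderOf (x : G) = 3 := by rw [Subgroup.orderOf_coe, hx]
    have hz : Subgroup.zpowers (x : G) ≤ A.T := A.le_T (by
      rw [Nat.card_zpowers, hxo]; norm_num)
    have : (x : G) ∈ H ⊓ A.T := ⟨x.2, hz (Subgroup.mem_zpowers _)⟩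
    rw [hb, Subgroup.mem_bot] at this
    rw [this] at hxo
    simp at hxo
  have hb := A.big inf_le_right hne hs
  have hd : Nat.card (H ⊓ A.T : Subgroup G) ∣ 27 := by
    rw [← A.card_T]; exact Subgroup.card_dvd_of_le inf_le_right
  have h27 : Nat.card (H ⊓ A.T : Subgroup G) = 27 := by
    have : Nat.card (H ⊓ A.T : Subgroup G) ≤ 27 := Nat.le_of_dvd (by norm_num) hd
    generalize Nat.card (H ⊓ A.T : Subgroup G) = n at *
    interval_cases n <;> omega
  have := Subgroup.eq_of_le_of_card_ge (inf_le_right : H ⊓ A.T ≤ A.T) (by rw [h27, A.card_T])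
  rw [← this]
  exact inf_le_left

theorem cards (A : Aff G) (H : Subgroup G) : Nat.card H = 1 ∨ Nat.card H = 3 ∨ Nat.card H = 9 ∨
    Nat.card H = 27 ∨ Nat.card H = 13 ∨ Nat.card H = 351 := by
  have hd := Subgroup.card_subgroup_dvd_card H
  by_cases h : 13 ∣ Nat.card H ∧ 3 ∣ Nat.card H
  · have := A.eq_top h.1 h.2
    subst this
    simp [A.card_G]
  · rw [A.card_G] at hd
    have : Nat.card H ∈ Nat.divisors 351 := by simpa using hd
    rw [show Nat.divisors 351 = {1, 3, 9, 13, 27, 39, 117, 351} by decide +kernel] at this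
    simp only [Finset.mem_insert, Finset.mem_singleton] at this
    omega

/-- The additive subgroup corresponding to a subgroup. -/
def W (A : Aff G) (H : Subgroup G) : AddSubgroup F27 where
  carrier := { b | A.tr b ∈ H }
  zero_mem' := by simp [A.tr_zero, H.one_mem]
  add_mem' := by
    intro a b ha hb
    simp only [Set.mem_ofPred_eq, A.tr_add] at *
    exact H.mul_mem ha hb
  neg_mem' := by
    intro a ha
    simp only [Set.mem_ofPred_eq, A.tr_neg] at *
    exact H.inv_mem ha

theorem card_W (A : Aff G) {H : Subgroup G} (h : H ≤ A.T) : Nat.card (A.W H) = Nat.card H := by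
  refine Nat.card_congr (Equiv.ofBijective (fun b => (⟨A.tr b.1, b.2⟩ : H)) ⟨?_, ?_⟩)
  · intro b c h
    exact Subtype.ext (A.tr_inj (congrArg Subtype.val h))
  · rintro ⟨g, hg⟩
    obtain ⟨b, rfl⟩ := A.mem_T.1 (h hg)
    exact ⟨⟨b, hg⟩, rfl⟩

/-- Conjugacy from a scaling between the additive subgroups. -/
theorem conj_of (A : Aff G) (H₁ H₂ : Subgroup G) (h1 : H₁ ≤ A.T) (hc : Nat.card H₁ = Nat.card H₂)
    (u : F27ˣ) (h : ∀ b ∈ A.W H₁, u * b ∈ A.W H₂) :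
    ∃ g : G, Subgroup.map (MulAut.conj g).toMonoidHom H₁ = H₂ := by
  have := A.finite
  obtain ⟨c, hu⟩ := f27_square_or u
  obtain ⟨g, hg⟩ := (A.range (c ^ 2)).2 ⟨c, rfl⟩
  refine ⟨g, Subgroup.eq_of_le_of_card_ge ?_ (by rw [card_conj, hc])⟩
  rintro _ ⟨x, hx, rfl⟩
  obtain ⟨b, rfl⟩ := A.mem_T.1 (h1 hx)
  have hb := h b hx
  show g * A.tr b * g⁻¹ ∈ H₂
  rw [A.conj, hg]
  rcases hu with hu | hu
  · rw [← hu]; exact hb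
  · have hb' := (A.W H₂).neg_mem hb
    rw [hu] at hb'
    have : -(((-c ^ 2 : F27ˣ) : F27) * b) = ((c ^ 2 : F27ˣ) : F27) * b := by
      simp
    rw [this] at hb'
    exact hb'

theorem conj3 (A : Aff G) (H₁ H₂ : Subgroup G) (h1 : Nat.card H₁ = 3) (h2 : Nat.card H₂ = 3) :
    ∃ g : G, Subgroup.map (MulAut.conj g).toMonoidHom H₁ = H₂ := by
  have := A.finite
  have : Fact (Nat.Prime 3) := ⟨by norm_num⟩
  have hT1 := A.le_T (H := H₁) (by rw [h1]; norm_num)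
  have hT2 := A.le_T (H := H₂) (by rw [h2]; norm_num)
  have c1 := A.card_W hT1
  have c2 := A.card_W hT2
  rw [h1] at c1
  rw [h2] at c2
  have ex : ∀ V : AddSubgroup F27, Nat.card V = 3 → ∃ u : F27ˣ, (u : F27) ∈ V := by
    intro V hV
    have : V ≠ ⊥ := by rintro rfl; simp at hV
    obtain ⟨x, hx⟩ := AddSubgroup.ne_bot_iff_exists_ne_zero.1 this
    exact ⟨Units.mk0 x.1 (fun h => hx (Subtype.ext h)), x.2⟩
  obtain ⟨u, hu⟩ := ex _ c1
  obtain ⟨v, hv⟩ := ex _ c2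
  refine A.conj_of H₁ H₂ hT1 (by rw [h1, h2]) (v / u) ?_
  intro b hb
  have htop := zmultiples_eq_top_of_prime_card (p := 3) c1 (g := (⟨u, hu⟩ : A.W H₁))
    (fun h => u.ne_zero (congrArg Subtype.val h))
  have : (⟨b, hb⟩ : A.W H₁) ∈ AddSubgroup.zmultiples (⟨u, hu⟩ : A.W H₁) := by
    rw [htop]; trivial
  obtain ⟨k, hk⟩ := this
  have hk' : k • (u : F27) = b := congrArg Subtype.val hk
  rw [← hk', mul_smul_comm, Units.val_div_eq_div_val, div_mul_cancel₀ _ u.ne_zero]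
  exact (A.W H₂).zsmul_mem hv k

theorem ker_trace (V : AddSubgroup F27) (hV : Nat.card V = 9) :
    ∃ u : F27ˣ, ∀ x : F27, x ∈ V ↔ Algebra.trace (ZMod 3) F27 (u * x) = 0 := by
  have hfd : FiniteDimensional (ZMod 3) F27 := inferInstance
  let V' := AddSubgroup.toZModSubmodule 3 V
  have hlt : V' < ⊤ := by
    rw [lt_top_iff_ne_top]
    intro h
    have : V = ⊤ := by
      ext x
      have : x ∈ V' := by rw [h]; trivial
      simpa [V'] using this
    rw [this] at hV
    have := f27_card
    simp at hV
    omega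
  obtain ⟨f, hf0, hf⟩ := Submodule.exists_le_ker_of_lt_top V' hlt
  have hnd := traceForm_nondegenerate (ZMod 3) F27
  obtain ⟨c, hc⟩ := ((Algebra.traceForm (ZMod 3) F27).toDual hnd).surjective f
  have hcx : ∀ x, f x = Algebra.trace (ZMod 3) F27 (c * x) := by
    intro x
    rw [← hc]
    simp [LinearMap.BilinForm.toDual_def, Algebra.traceForm_apply]
  have hc0 : c ≠ 0 := by
    rintro rfl
    apply hf0
    ext x
    simp [hcx]
  refine ⟨Units.mk0 c hc0, ?_⟩
  have hker : V = (LinearMap.ker f).toAddSubgroup := by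
    apply AddSubgroup.eq_of_le_of_card_ge
    · intro x hx
      exact hf (show x ∈ V' by simpa [V'] using hx)
    · have hd : Nat.card (LinearMap.ker f).toAddSubgroup ∣ 27 := by
        rw [← f27_card]; exact AddSubgroup.card_addSubgroup_dvd_card _
      have hne : Nat.card (LinearMap.ker f).toAddSubgroup ≠ 27 := by
        intro h
        rw [← f27_card] at h
        have := AddSubgroup.eq_top_of_card_eq _ h
        apply hf0
        ext x
        have hx : x ∈ (LinearMap.ker f).toAddSubgroup := by rw [this]; trivial
        exact hx
      rw [hV]
      have : Nat.card (LinearMap.ker f).toAddSubgroup ≤ 27 := Nat.le_of_dvd (by norm_num) hd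
      generalize Nat.card (LinearMap.ker f).toAddSubgroup = n at *
      interval_cases n <;> omega
  intro x
  rw [Units.val_mk0, ← hcx]
  rw [hker]
  rfl

theorem conj9 (A : Aff G) (H₁ H₂ : Subgroup G) (h1 : Nat.card H₁ = 9) (h2 : Nat.card H₂ = 9) :
    ∃ g : G, Subgroup.map (MulAut.conj g).toMonoidHom H₁ = H₂ := by
  have hT1 := A.le_T (H := H₁) (by rw [h1]; norm_num)
  have hT2 := A.le_T (H := H₂) (by rw [h2]; norm_num)
  obtain ⟨u, hu⟩ := ker_trace (A.W H₁) (by rw [A.card_W hT1, h1])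
  obtain ⟨v, hv⟩ := ker_trace (A.W H₂) (by rw [A.card_W hT2, h2])
  refine A.conj_of H₁ H₂ hT1 (by rw [h1, h2]) (u / v) ?_
  intro b hb
  rw [hv, ← mul_assoc, Units.val_div_eq_div_val, mul_div_cancel₀ _ v.ne_zero]
  exact (hu b).1 hb

theorem fact13 (A : Aff G) : (Nat.card G).factorization 13 = 1 := by
  rw [A.card_G, show (351 : ℕ) = 13 ^ 1 * 27 by norm_num]
  rw [Nat.factorization_def _ (by norm_num)]
  have : Fact (Nat.Prime 13) := ⟨by norm_num⟩
  rw [padicValNat.mul (by norm_num) (by norm_num), padicValNat.prime_pow,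
    padicValNat.eq_zero_of_not_dvd (by norm_num)]

theorem conj13 (A : Aff G) (H₁ H₂ : Subgroup G) (h1 : Nat.card H₁ = 13) (h2 : Nat.card H₂ = 13) :
    ∃ g : G, Subgroup.map (MulAut.conj g).toMonoidHom H₁ = H₂ := by
  have := A.finite
  have : Fact (Nat.Prime 13) := ⟨by norm_num⟩
  obtain ⟨g, hg⟩ := MulAction.exists_smul_eq G
    (Sylow.ofCard H₁ (by rw [A.fact13, h1, pow_one]))
    (Sylow.ofCard H₂ (by rw [A.fact13, h2, pow_one]))
  exact ⟨g, congrArg Sylow.toSubgroup hg⟩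

theorem count13 (A : Aff G) : { H : Subgroup G | Nat.card H = 13 }.ncard = 27 := by
  have := A.finite
  have : Fact (Nat.Prime 13) := ⟨by norm_num⟩
  have hS : ∀ P : Sylow 13 G, Nat.card P = 13 := by
    intro P; rw [P.card_eq_multiplicity, A.fact13, pow_one]
  have hset : { H : Subgroup G | Nat.card H = 13 } = Set.range (Sylow.toSubgroup (p := 13) (G := G)) := by
    ext H
    constructor
    · intro h
      exact ⟨Sylow.ofCard H (by rw [A.fact13, pow_one]; exact h), rfl⟩
    · rintro ⟨P, rfl⟩
      exact hS P
  have hinj : Function.Injective (Sylow.toSubgroup (p := 13) (G := G)) := fun P Q h => Sylow.ext h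
  rw [hset, ← Set.image_univ, Set.ncard_image_of_injective _ hinj, Set.ncard_univ]
  have hmod := card_sylow_modEq_one 13 G
  obtain ⟨P⟩ : Nonempty (Sylow 13 G) := inferInstance
  have hdvd := P.card_dvd_index
  have hidx : (P : Subgroup G).index = 27 := by
    have h := (P : Subgroup G).card_mul_index
    rw [A.card_G, hS P] at h
    omega
  rw [hidx] at hdvd
  have hne : Nat.card (Sylow 13 G) ≠ 1 := by
    intro h1
    have hsub : Subsingleton (Sylow 13 G) := (Nat.card_eq_one_iff_unique.1 h1).1
    have hn : (P : Subgroup G).Normal := Sylow.normal_of_subsingleton P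
    have hdis : Disjoint (P : Subgroup G) A.T := by
      rw [disjoint_iff]
      apply Subgroup.inf_eq_bot_of_coprime
      rw [hS P, A.card_T]; norm_num
    have hle : (P : Subgroup G) ≤ A.T := by
      intro x hx
      have hcm := Subgroup.commute_of_normal_of_disjoint _ _ hn A.T_normal hdis x (A.tr 1) hx (A.tr_mem 1)
      have h2 := A.conj x 1
      rw [hcm.eq, mul_inv_cancel_right] at h2
      have h3 := A.tr_inj h2
      show A.lin x = 1
      ext
      simpa using h3.symm
    have := Subgroup.card_dvd_of_le hle
    rw [hS P, A.card_T] at this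
    norm_num at this
  have hle : Nat.card (Sylow 13 G) ≤ 27 := Nat.le_of_dvd (by norm_num) hdvd
  unfold Nat.ModEq at hmod
  generalize Nat.card (Sylow 13 G) = n at *
  interval_cases n <;> omega

theorem eq_T (A : Aff G) {H : Subgroup G} (h : Nat.card H = 27) : H = A.T := by
  have := A.finite
  exact Subgroup.eq_of_le_of_card_ge (A.le_T (by rw [h])) (by rw [h, A.card_T])

theorem conj_all (A : Aff G) (H₁ H₂ : Subgroup G) (h : Nat.card H₁ = Nat.card H₂) :
    ∃ g : G, Subgroup.map (MulAut.conj g).toMonoidHom H₁ = H₂ := by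
  have := A.finite
  have triv : H₁ = H₂ → ∃ g : G, Subgroup.map (MulAut.conj g).toMonoidHom H₁ = H₂ := by
    rintro rfl
    exact ⟨1, (stab H₁).one_mem⟩
  rcases A.cards H₁ with h1 | h1 | h1 | h1 | h1 | h1
  · apply triv
    exact (Subgroup.eq_bot_of_card_eq H₁ h1).trans (Subgroup.eq_bot_of_card_eq H₂ (h ▸ h1)).symm
  · exact A.conj3 _ _ h1 (h ▸ h1)
  · exact A.conj9 _ _ h1 (h ▸ h1)
  · exact triv ((A.eq_T h1).trans (A.eq_T (h ▸ h1)).symm)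
  · exact A.conj13 _ _ h1 (h ▸ h1)
  · apply triv
    rw [Subgroup.eq_top_of_card_eq H₁ (by rw [h1, A.card_G]),
      Subgroup.eq_top_of_card_eq H₂ (by rw [← h, h1, A.card_G])]

theorem class_eq (A : Aff G) (H : Subgroup G) :
    { H' | ∃ g : G, Subgroup.map (MulAut.conj g).toMonoidHom H = H' } =
      { H' : Subgroup G | Nat.card H' = Nat.card H } := by
  ext H'
  constructor
  · rintro ⟨g, rfl⟩
    exact card_conj H g
  · intro h
    exact A.conj_all H H' h.symm

theorem exists_card (A : Aff G) {n : ℕ} (hn : n ∈ ({1, 3, 9, 13, 27, 351} : Finset ℕ)) :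
    ∃ H : Subgroup G, Nat.card H = n := by
  have := A.finite
  have : Fact (Nat.Prime 13) := ⟨by norm_num⟩
  have : Fact (Nat.Prime 3) := ⟨by norm_num⟩
  simp only [Finset.mem_insert, Finset.mem_singleton] at hn
  rcases hn with rfl | rfl | rfl | rfl | rfl | rfl
  · exact ⟨⊥, by simp⟩
  · simpa using Sylow.exists_subgroup_card_pow_prime (G := G) 3 (n := 1) (by rw [A.card_G]; norm_num)
  · simpa using Sylow.exists_subgroup_card_pow_prime (G := G) 3 (n := 2) (by rw [A.card_G]; norm_num)
  · simpa using Sylow.exists_subgroup_card_pow_prime (G := G) 13 (n := 1) (by rw [A.card_G]; norm_num)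
  · exact ⟨A.T, A.card_T⟩
  · exact ⟨⊤, by simp [A.card_G]⟩

theorem count_small (A : Aff G) {n : ℕ} (hn : n = 3 ∨ n = 9) :
    { H : Subgroup G | Nat.card H = n }.ncard = 13 := by
  obtain ⟨H, hH⟩ := A.exists_card (n := n) (by rcases hn with rfl | rfl <;> simp)
  rw [← hH, ← A.class_eq H, ← index_stab]
  apply A.index_stab_small <;> rw [hH] <;> rcases hn with rfl | rfl <;> norm_num

theorem count_classes (A : Aff G) :
    { C : Set (Subgroup G) | ∃ H : Subgroup G,
        C = { H' | ∃ g : G, Subgroup.map (MulAut.conj g).toMonoidHom H = H' } }.ncard = 6 := by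
  have hset : { C : Set (Subgroup G) | ∃ H : Subgroup G,
        C = { H' | ∃ g : G, Subgroup.map (MulAut.conj g).toMonoidHom H = H' } } =
      (fun n : ℕ => { H : Subgroup G | Nat.card H = n }) ''
        (({1, 3, 9, 13, 27, 351} : Finset ℕ) : Set ℕ) := by
    ext C
    constructor
    · rintro ⟨H, rfl⟩
      refine ⟨Nat.card H, ?_, (A.class_eq H).symm⟩
      have := A.cards H
      simp only [Finset.mem_coe, Finset.mem_insert, Finset.mem_singleton]
      omega
    · rintro ⟨n, hn, rfl⟩
      obtain ⟨H, rfl⟩ := A.exists_card (Finset.mem_coe.1 hn)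
      exact ⟨H, (A.class_eq H).symm⟩
  rw [hset, Set.InjOn.ncard_image, Set.ncard_coe_finset]
  · rfl
  · intro n hn m _ hnm
    obtain ⟨H, hH⟩ := A.exists_card (Finset.mem_coe.1 hn)
    have h1 : H ∈ { H : Subgroup G | Nat.card H = n } := hH
    have h2 : { H : Subgroup G | Nat.card H = n } = { H : Subgroup G | Nat.card H = m } := hnm
    rw [h2] at h1
    exact hH.symm.trans h1

end Aff

/-- `G₃₅₁` has exactly one subgroup of order 27 (which is normal), exactly 13 subgroups of
order 3, exactly 13 of order 9, exactly 27 of order 13; any two subgroups of the same order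
are conjugate; and there are exactly 6 conjugacy classes of subgroups. -/
theorem statement15 (G : Subgroup (Equiv.Perm F27))
    (hG : (G : Set (Equiv.Perm F27)) = affineSet) :
    (∃! H : Subgroup G, Nat.card H = 27) ∧
    (∀ H : Subgroup G, Nat.card H = 27 → H.Normal) ∧
    { H : Subgroup G | Nat.card H = 3 }.ncard = 13 ∧
    { H : Subgroup G | Nat.card H = 9 }.ncard = 13 ∧
    { H : Subgroup G | Nat.card H = 13 }.ncard = 27 ∧
    (∀ H₁ H₂ : Subgroup G, Nat.card H₁ = Nat.card H₂ →
      ∃ g : G, Subgroup.map (MulAut.conj g).toMonoidHom H₁ = H₂) ∧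
    { C : Set (Subgroup G) | ∃ H : Subgroup G,
        C = { H' | ∃ g : G, Subgroup.map (MulAut.conj g).toMonoidHom H = H' } }.ncard
      = 6 := by
  obtain ⟨A⟩ := exists_aff G hG
  refine ⟨⟨A.T, A.card_T, fun H hH => A.eq_T hH⟩, fun H hH => ?_, A.count_small (Or.inl rfl),
    A.count_small (Or.inr rfl), A.count13, A.conj_all, A.count_classes⟩
  rw [A.eq_T hH]
  exact A.T_normal
end
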